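/- For every finite alphabet Σ and all m, n ∈ ℕ: the finite quotient monoid Σ*/≡_{m,n}^X is in R_m; Σ*/≡_{m,n}^Y is in L_m; Σ*/≡_{m,n}^{XY} is in R_m ∨ L_m; and Σ*/≡_{m,n}^{WI} is in R_{m+1} ∩ L_{m+1}. -/

import Mathlib

open scoped Classical

/-! ## Generalized words -/

structure GWord (A : Type) : Type 1 where
  P : Type
  ord : LinearOrder P
  w : P → A

namespace GWord

variable {A : Type}

instance (u : GWord A) : LinearOrder u.P := u.ord

/-- The set of letters occurring in a generalized word. -/
def alph (u : GWord A) : Set A := Set.range u.w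

/-- Restriction of a generalized word to a set of positions. -/
def restrict (u : GWord A) (s : Set u.P) : GWord A :=
  ⟨{ p // p ∈ s }, inferInstance, fun p => u.w p.1⟩

/-- `p` is the first `a`-labelled position of `u`. -/
def IsFirst (u : GWord A) (a : A) (p : u.P) : Prop :=
  u.w p = a ∧ ∀ q : u.P, u.w q = a → p ≤ q

/-- `p` is the last `a`-labelled position of `u`. -/
def IsLast (u : GWord A) (a : A) (p : u.P) : Prop :=
  u.w p = a ∧ ∀ q : u.P, u.w q = a → q ≤ p

/-- The factor strictly before the first occurrence of `a`. -/
noncomputable def XL (u : GWord A) (a : A) : GWord A :=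
  if h : ∃ p, u.IsFirst a p then u.restrict {q | q < h.choose} else u

/-- The factor strictly after the first occurrence of `a`. -/
noncomputable def XR (u : GWord A) (a : A) : GWord A :=
  if h : ∃ p, u.IsFirst a p then u.restrict {q | h.choose < q} else u

/-- The factor strictly before the last occurrence of `a`. -/
noncomputable def YL (u : GWord A) (a : A) : GWord A :=
  if h : ∃ p, u.IsLast a p then u.restrict {q | q < h.choose} else u

/-- The factor strictly after the last occurrence of `a`. -/
noncomputable def YR (u : GWord A) (a : A) : GWord A :=
  if h : ∃ p, u.IsLast a p then u.restrict {q | h.choose < q} else u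

/-- `C_{a,b}` is defined iff the first `a` is strictly to the right of the last `b`. -/
def CDefined (u : GWord A) (a b : A) : Prop :=
  ∃ p q, u.IsFirst a p ∧ u.IsLast b q ∧ q < p

/-- The factor strictly between the last `b` and the first `a` (junk value if undefined). -/
noncomputable def Cab (u : GWord A) (a b : A) : GWord A :=
  if h : u.CDefined a b then
    u.restrict {r | h.choose_spec.choose < r ∧ r < h.choose}
  else u

/-- Accessibility: first/last occurrences of letters after/before every position exist. -/
def Accessible (u : GWord A) : Prop :=
  (∀ a : A, (∃ p, u.w p = a) → ∃ p, u.IsFirst a p) ∧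
  (∀ a : A, (∃ p, u.w p = a) → ∃ p, u.IsLast a p) ∧
  (∀ (p : u.P) (a : A), (∃ q, p < q ∧ u.w q = a) →
    ∃ q, p < q ∧ u.w q = a ∧ ∀ r, p < r → u.w r = a → q ≤ r) ∧
  (∀ (p : u.P) (a : A), (∃ q, q < p ∧ u.w q = a) →
    ∃ q, q < p ∧ u.w q = a ∧ ∀ r, r < p → u.w r = a → r ≤ q)

/-- Concatenation of generalized words. -/
def append (u v : GWord A) : GWord A :=
  ⟨u.P ⊕ₗ v.P, inferInstance, fun x => Sum.elim u.w v.w (ofLex x)⟩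

/-- The power of a generalized word by an arbitrary linear order type `ν`
(positions ordered with the exponent component dominant). -/
def gpow (u : GWord A) (ν : Type) [LinearOrder ν] : GWord A :=
  ⟨ν ×ₗ u.P, inferInstance, fun x => u.w (ofLex x).2⟩

/-- A finite word as a generalized word. -/
def ofList (l : List A) : GWord A :=
  ⟨Fin l.length, inferInstance, fun i => l.get i⟩

end GWord

/-- The order type `ω + ω*`: a copy of `ℕ` followed by a reversed copy of `ℕ`. -/
abbrev OO : Type := ℕ ⊕ₗ ℕᵒᵈ

/-! ## The relations `≡_{m,n}^Z` -/

inductive ZK : Type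
  | X | Y | WI

inductive ZKind : Type
  | X | Y | XY | WI

/-- The relations `≡_{m,n}^X`, `≡_{m,n}^Y`, `≡_{m,n}^{WI}` (first argument is `n`). -/
def eqvAux {A : Type} : ℕ → ZK → ℕ → GWord A → GWord A → Prop
  | 0, _, _, _, _ => True
  | _ + 1, _, 0, _, _ => True
  | n + 1, ZK.X, m + 1, u, v =>
      u.alph = v.alph ∧ eqvAux n ZK.Y m u v ∧
      ∀ a ∈ u.alph, eqvAux n ZK.Y m (u.XL a) (v.XL a) ∧
        eqvAux n ZK.X (m + 1) (u.XR a) (v.XR a)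
  | n + 1, ZK.Y, m + 1, u, v =>
      u.alph = v.alph ∧ eqvAux n ZK.X m u v ∧
      ∀ a ∈ u.alph, eqvAux n ZK.Y (m + 1) (u.YL a) (v.YL a) ∧
        eqvAux n ZK.X m (u.YR a) (v.YR a)
  | n + 1, ZK.WI, m + 1, u, v =>
      u.alph = v.alph ∧
      (∀ a ∈ u.alph,
        eqvAux n ZK.WI m (u.XL a) (v.XL a) ∧ eqvAux n ZK.WI (m + 1) (u.XR a) (v.XR a) ∧
        eqvAux n ZK.WI (m + 1) (u.YL a) (v.YL a) ∧ eqvAux n ZK.WI m (u.YR a) (v.YR a)) ∧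
      ∀ a ∈ u.alph, ∀ b ∈ u.alph,
        (u.CDefined a b ↔ v.CDefined a b) ∧
        (u.CDefined a b → v.CDefined a b → eqvAux n ZK.WI m (u.Cab a b) (v.Cab a b))

/-- `wEquiv Z m n u v` is `u ≡_{m,n}^Z v`. -/
def wEquiv {A : Type} (Z : ZKind) (m n : ℕ) (u v : GWord A) : Prop :=
  match Z with
  | ZKind.X => eqvAux n ZK.X m u v
  | ZKind.Y => eqvAux n ZK.Y m u v
  | ZKind.XY => eqvAux n ZK.X m u v ∧ eqvAux n ZK.Y m u v
  | ZKind.WI => eqvAux n ZK.WI m u v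

/-! ## π-terms -/

inductive PiTerm (A : Type) : Type
  | eps : PiTerm A
  | letter : A → PiTerm A
  | mul : PiTerm A → PiTerm A → PiTerm A
  | pi : PiTerm A → PiTerm A

def listNPow {A : Type} (l : List A) : ℕ → List A
  | 0 => []
  | k + 1 => l ++ listNPow l k

/-- `[γ]_k`: substitute the natural number `k` for the formal power `π`. -/
def PiTerm.substNat {A : Type} : PiTerm A → ℕ → List A
  | .eps, _ => []
  | .letter a, _ => [a]
  | .mul α β, k => α.substNat k ++ β.substNat k
  | .pi γ, k => listNPow (γ.substNat k) k

/-- `[γ]_{ω+ω*}`: substitute the order type `ω + ω*` for the formal power `π`. -/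
def PiTerm.substOO {A : Type} : PiTerm A → GWord A
  | .eps => GWord.ofList []
  | .letter a => GWord.ofList [a]
  | .mul α β => α.substOO.append β.substOO
  | .pi γ => γ.substOO.gpow OO

/-! ## Finite monoids, equations, the Trotter–Weil hierarchy -/

/-- `M!`: the exponent of a finite monoid, the least `n ≥ 1` such that all `x^n` are
idempotent. -/
noncomputable def monoidExp (M : Type) [Monoid M] : ℕ :=
  sInf {n : ℕ | 1 ≤ n ∧ ∀ x : M, IsIdempotentElem (x ^ n)}

/-- The equation `α = β` of π-terms holds in the finite monoid `M`. -/
def EqHoldsIn {A : Type} (α β : PiTerm A) (M : Type) [Monoid M] : Prop :=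
  ∀ σ : FreeMonoid A →* M,
    σ (FreeMonoid.ofList (α.substNat (monoidExp M))) =
      σ (FreeMonoid.ofList (β.substNat (monoidExp M)))

/-- Green's relation `R`: `x R y` iff `xM = yM`. -/
def rGreen {M : Type} [Monoid M] (x y : M) : Prop :=
  Set.range (fun z => x * z) = Set.range (fun z => y * z)

/-- Green's relation `L`: `x L y` iff `Mx = My`. -/
def lGreen {M : Type} [Monoid M] (x y : M) : Prop :=
  Set.range (fun z => z * x) = Set.range (fun z => z * y)

/-- `J`-triviality: `MxM = MyM` implies `x = y`. -/
def IsJTrivial (M : Type) [Monoid M] : Prop :=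
  ∀ x y : M, {z | ∃ a b, z = a * x * b} = {z | ∃ a b, z = a * y * b} → x = y

/-- The relation `∼_K`. -/
def simK {M : Type} [Monoid M] (x y : M) : Prop :=
  ∀ e : M, IsIdempotentElem e → (rGreen (e * x) e ∨ rGreen (e * y) e) → e * x = e * y

/-- The relation `∼_D`. -/
def simD {M : Type} [Monoid M] (x y : M) : Prop :=
  ∀ e : M, IsIdempotentElem e → (lGreen (x * e) e ∨ lGreen (y * e) e) → x * e = y * e

/-- `∼_K` as a congruence (it is a congruence, so `conGen` does not change it). -/
def KCon (M : Type) [Monoid M] : Con M := conGen simK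

/-- `∼_D` as a congruence. -/
def DCon (M : Type) [Monoid M] : Con M := conGen simD

/-- `InRLAux k true M _ = (M ∈ R_{k+1})` and `InRLAux k false M _ = (M ∈ L_{k+1})`. -/
def InRLAux : ℕ → Bool → (M : Type) → Monoid M → Prop
  | 0, _, M, i => letI := i; IsJTrivial M
  | k + 1, true, M, i => letI := i; InRLAux k false (KCon M).Quotient inferInstance
  | k + 1, false, M, i => letI := i; InRLAux k true (DCon M).Quotient inferInstance

/-- `M ∈ R_m` (for `m ≥ 1`). -/
def InRm (m : ℕ) (M : Type) [i : Monoid M] : Prop := InRLAux (m - 1) true M i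

/-- `M ∈ L_m` (for `m ≥ 1`). -/
def InLm (m : ℕ) (M : Type) [i : Monoid M] : Prop := InRLAux (m - 1) false M i

/-- `N` divides `M`: `N` is a homomorphic image of a submonoid of `M`. -/
def MDivides (N M : Type) [Monoid N] [Monoid M] : Prop :=
  ∃ (S : Submonoid M) (f : S →* N), Function.Surjective f

/-- `N ∈ R_m ∨ L_m`: `N` divides a direct product `M₁ × M₂` with `M₁ ∈ R_m`, `M₂ ∈ L_m`. -/
def InJoin (m : ℕ) (N : Type) [Monoid N] : Prop :=
  ∃ (M₁ M₂ : Type) (i₁ : Monoid M₁) (i₂ : Monoid M₂),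
    letI := i₁; letI := i₂;
    Finite M₁ ∧ Finite M₂ ∧ InRm m M₁ ∧ InLm m M₂ ∧ MDivides N (M₁ × M₂)

/-- `M ∈ DA`, via the equation `(xyz)^{M!} y (xyz)^{M!} = (xyz)^{M!}`. -/
def InDA (M : Type) [Monoid M] : Prop :=
  ∀ x y z : M,
    (x * y * z) ^ monoidExp M * y * (x * y * z) ^ monoidExp M = (x * y * z) ^ monoidExp M

/-! ## The π-terms `U_m`, `V_m` -/

inductive UVLetter : Type
  | s | t | x (i : ℕ) | y (i : ℕ)

/-- `U_m` (indexed from 1; `Uterm 0` is a junk value). -/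
def Uterm : ℕ → PiTerm UVLetter
  | 0 => PiTerm.eps
  | 1 =>
      PiTerm.mul
        (PiTerm.pi (PiTerm.mul (PiTerm.letter UVLetter.s) (PiTerm.letter (UVLetter.x 1))))
        (PiTerm.mul (PiTerm.letter UVLetter.s)
          (PiTerm.pi (PiTerm.mul (PiTerm.letter (UVLetter.y 1)) (PiTerm.letter UVLetter.t))))
  | m + 2 =>
      PiTerm.mul
        (PiTerm.pi (PiTerm.mul (Uterm (m + 1)) (PiTerm.letter (UVLetter.x (m + 2)))))
        (PiTerm.mul (Uterm (m + 1))
          (PiTerm.pi (PiTerm.mul (PiTerm.letter (UVLetter.y (m + 2))) (Uterm (m + 1)))))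

/-- `V_m` (indexed from 1; `Vterm 0` is a junk value). -/
def Vterm : ℕ → PiTerm UVLetter
  | 0 => PiTerm.eps
  | 1 =>
      PiTerm.mul
        (PiTerm.pi (PiTerm.mul (PiTerm.letter UVLetter.s) (PiTerm.letter (UVLetter.x 1))))
        (PiTerm.mul (PiTerm.letter UVLetter.t)
          (PiTerm.pi (PiTerm.mul (PiTerm.letter (UVLetter.y 1)) (PiTerm.letter UVLetter.t))))
  | m + 2 =>
      PiTerm.mul
        (PiTerm.pi (PiTerm.mul (Uterm (m + 1)) (PiTerm.letter (UVLetter.x (m + 2)))))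
        (PiTerm.mul (Vterm (m + 1))
          (PiTerm.pi (PiTerm.mul (PiTerm.letter (UVLetter.y (m + 2))) (Uterm (m + 1)))))

/-- The relation `≡_{m,n}^Z` on the free monoid `Σ*`, as a congruence
(it is a congruence, so `conGen` does not change it). -/
def eqvCon (A : Type) (Z : ZKind) (m n : ℕ) : Con (FreeMonoid A) :=
  conGen (fun u v => wEquiv Z m n (GWord.ofList u.toList) (GWord.ofList v.toList))

/-! ## Words read in either direction -/

section Directed

variable {A : Type}

/-- Concatenation in reading direction: `b = true` reads from the left, `b = false` from the
right. -/
def dcat (b : Bool) (x y : List A) : List A := bif b then x ++ y else y ++ x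

/-- In reading direction `b`, the first occurrence of `a` splits `u` into `p`, `a` and `q`. -/
def DSplit (b : Bool) (u p : List A) (a : A) (q : List A) : Prop :=
  u = dcat b p (dcat b [a] q) ∧ a ∉ p

theorem dcat_not (b : Bool) (x y : List A) : dcat (!b) x y = dcat b y x := by
  cases b <;> rfl

theorem dcat_assoc (b : Bool) (x y z : List A) :
    dcat b (dcat b x y) z = dcat b x (dcat b y z) := by
  cases b <;> simp [dcat]

@[simp] theorem mem_dcat {b : Bool} {x y : List A} {a : A} :
    a ∈ dcat b x y ↔ a ∈ x ∨ a ∈ y := by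
  cases b <;> simp [dcat, or_comm]

theorem exists_dsplit (b : Bool) {u : List A} {a : A} (h : a ∈ u) :
    ∃ p q, DSplit b u p a q := by
  cases b
  · obtain ⟨p, q, hu, hp⟩ := List.eq_append_cons_of_mem (List.mem_reverse.2 h)
    refine ⟨p.reverse, q.reverse, ?_, by simpa using hp⟩
    simpa [dcat] using congrArg List.reverse hu
  · obtain ⟨p, q, hu, hp⟩ := List.eq_append_cons_of_mem h
    exact ⟨p, q, hu, hp⟩

theorem append_cons_unique {p q p' q' : List A} {a : A} (h : p ++ a :: q = p' ++ a :: q')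
    (hp : a ∉ p) (hp' : a ∉ p') : p = p' ∧ q = q' := by
  induction p generalizing p' with
  | nil =>
    cases p' with
    | nil => exact ⟨rfl, (List.cons.inj h).2⟩
    | cons y p' =>
      simp only [List.nil_append, List.cons_append, List.cons.injEq] at h
      exact absurd (by simp [h.1]) hp'
  | cons x p ih =>
    cases p' with
    | nil =>
      simp only [List.nil_append, List.cons_append, List.cons.injEq] at h
      exact absurd (by simp [h.1]) hp
    | cons y p' =>
      simp only [List.cons_append, List.cons.injEq, List.mem_cons, not_or] at h hp hp'
      obtain ⟨h1, h2⟩ := ih h.2 hp.2 hp'.2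
      exact ⟨by rw [h.1, h1], h2⟩

theorem DSplit.unique {b : Bool} {u p q p' q' : List A} {a : A} (h : DSplit b u p a q)
    (h' : DSplit b u p' a q') : p = p' ∧ q = q' := by
  obtain ⟨h, hp⟩ := h
  obtain ⟨h', hp'⟩ := h'
  rw [h] at h'
  cases b
  · have := congrArg List.reverse h'
    simp only [dcat, cond_false, List.reverse_append, List.reverse_cons,
      List.nil_append, List.append_assoc, List.cons_append] at this
    simpa using append_cons_unique this (by simpa using hp) (by simpa using hp')
  · exact append_cons_unique h' hp hp'

theorem DSplit.mem {b : Bool} {u p q : List A} {a : A} (h : DSplit b u p a q) : a ∈ u := by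
  simp [h.1]

theorem DSplit.cat_right {b : Bool} {u p q : List A} {a : A} (h : DSplit b u p a q)
    (y : List A) : DSplit b (dcat b u y) p a (dcat b q y) :=
  ⟨by rw [h.1]; simp only [dcat_assoc], h.2⟩

theorem DSplit.cat_left {b : Bool} {u p q : List A} {a : A} (h : DSplit b u p a q)
    {x : List A} (hx : a ∉ x) : DSplit b (dcat b x u) (dcat b x p) a q :=
  ⟨by rw [h.1]; simp only [dcat_assoc], by simp [hx, h.2]⟩

/-- `DEqv n true m` is `≡_{m,n}^X` and `DEqv n false m` is `≡_{m,n}^Y` on finite words. -/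
def DEqv : ℕ → Bool → ℕ → List A → List A → Prop
  | 0, _, _, _, _ => True
  | _ + 1, _, 0, _, _ => True
  | n + 1, b, m + 1, u, v =>
      (∀ a, a ∈ u ↔ a ∈ v) ∧ DEqv n (!b) m u v ∧
      ∀ a p q p' q', DSplit b u p a q → DSplit b v p' a q' →
        DEqv n (!b) m p p' ∧ DEqv n b (m + 1) q q'

@[simp] theorem DEqv.zero_right (n : ℕ) (b : Bool) (u v : List A) : DEqv n b 0 u v := by
  cases n <;> trivial

theorem DEqv.exists_signature [Finite A] (n : ℕ) (b : Bool) (m : ℕ) :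
    ∃ (T : Type) (_ : Finite T) (f : List A → T), ∀ u v, f u = f v ↔ DEqv n b m u v := by
  induction n generalizing b m with
  | zero => exact ⟨Unit, inferInstance, fun _ => (), fun _ _ => by simp [DEqv]⟩
  | succ n ih =>
    cases m with
    | zero => exact ⟨Unit, inferInstance, fun _ => (), fun _ _ => by simp [DEqv]⟩
    | succ m =>
      obtain ⟨T₁, _, g, hg⟩ := ih (!b) m
      obtain ⟨T₂, _, h, hh⟩ := ih b (m + 1)
      refine ⟨Set A × T₁ × (A → Set (T₁ × T₂)), inferInstance, fun u =>
        ({a | a ∈ u}, g u, fun a => {t | ∃ p q, DSplit b u p a q ∧ t = (g p, h q)}), ?_⟩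
      intro u v
      simp only [Prod.mk.injEq, DEqv, hg, Set.ext_iff, Set.mem_ofPred_eq, funext_iff]
      refine and_congr_right fun halph => and_congr_right fun _ => ⟨?_, ?_⟩
      · intro H a p q p' q' hs hs'
        obtain ⟨p₁, q₁, hs₁, he⟩ := (H a _).1 ⟨p, q, hs, rfl⟩
        obtain ⟨rfl, rfl⟩ := hs'.unique hs₁
        simpa [hg, hh] using he
      · intro H a t
        constructor
        · rintro ⟨p, q, hs, rfl⟩
          obtain ⟨p', q', hs'⟩ := exists_dsplit b ((halph a).1 hs.mem)
          refine ⟨p', q', hs', ?_⟩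
          simpa [hg, hh] using H a p q p' q' hs hs'
        · rintro ⟨p', q', hs', rfl⟩
          obtain ⟨p, q, hs⟩ := exists_dsplit b ((halph a).2 hs'.mem)
          refine ⟨p, q, hs, ?_⟩
          have := H a p q p' q' hs hs'
          rw [← hg, ← hh] at this
          rw [this.1, this.2]

theorem DEqv.equivalence [Finite A] (n : ℕ) (b : Bool) (m : ℕ) :
    Equivalence (DEqv (A := A) n b m) := by
  obtain ⟨T, _, f, hf⟩ := DEqv.exists_signature (A := A) n b m
  refine ⟨fun u => (hf _ _).1 rfl, fun h => (hf _ _).1 ((hf _ _).2 h).symm,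
    fun h h' => (hf _ _).1 (((hf _ _).2 h).trans ((hf _ _).2 h'))⟩

theorem DEqv.mono {n : ℕ} {b : Bool} {m : ℕ} {u v : List A} (h : DEqv (n + 1) b m u v) :
    DEqv n b m u v := by
  induction n generalizing b m u v with
  | zero => trivial
  | succ n ih =>
    cases m with
    | zero => trivial
    | succ m =>
      exact ⟨h.1, ih h.2.1, fun a p q p' q' hs hs' =>
        ⟨ih (h.2.2 a p q p' q' hs hs').1, ih (h.2.2 a p q p' q' hs hs').2⟩⟩

theorem DEqv.cat {n : ℕ} {m : ℕ} (b : Bool) {c : Bool} {x y x' y' : List A}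
    (hx : DEqv n c m x x') (hy : DEqv n c m y y') :
    DEqv n c m (dcat b x y) (dcat b x' y') := by
  induction n generalizing b c m x y x' y' with
  | zero => trivial
  | succ n ih =>
    cases m with
    | zero => trivial
    | succ m =>
      have key : ∀ {x y x' y' : List A}, DEqv (n + 1) c (m + 1) x x' →
          DEqv (n + 1) c (m + 1) y y' →
          DEqv (n + 1) c (m + 1) (dcat c x y) (dcat c x' y') := by
        intro x y x' y' hx hy
        refine ⟨fun a => by simp [hx.1, hy.1], ih c hx.2.1 hy.2.1, ?_⟩
        intro a p q p' q' hs hs'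
        by_cases ha : a ∈ x
        · obtain ⟨p₁, q₁, h₁⟩ := exists_dsplit c ha
          obtain ⟨p₂, q₂, h₂⟩ := exists_dsplit c ((hx.1 a).1 ha)
          obtain ⟨rfl, rfl⟩ := hs.unique (h₁.cat_right y)
          obtain ⟨rfl, rfl⟩ := hs'.unique (h₂.cat_right y')
          have := hx.2.2 a _ _ _ _ h₁ h₂
          exact ⟨this.1, ih c this.2 hy.mono⟩
        · have hay : a ∈ y := by simpa [ha] using hs.mem
          obtain ⟨p₁, q₁, h₁⟩ := exists_dsplit c hay
          obtain ⟨p₂, q₂, h₂⟩ := exists_dsplit c ((hy.1 a).1 hay)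
          obtain ⟨rfl, rfl⟩ := hs.unique (h₁.cat_left ha)
          obtain ⟨rfl, rfl⟩ := hs'.unique (h₂.cat_left (fun h => ha ((hx.1 a).2 h)))
          have := hy.2.2 a _ _ _ _ h₁ h₂
          exact ⟨ih c hx.2.1 this.1, this.2⟩
      rcases Bool.eq_or_eq_not b c with rfl | rfl
      · exact key hx hy
      · rw [dcat_not, dcat_not]
        exact key hy hx

theorem dcat_flatten_replicate (b : Bool) (s : List A) (n : ℕ) :
    dcat b s (List.replicate n s).flatten = (List.replicate (n + 1) s).flatten := by
  cases b
  · simp [dcat, List.replicate_succ']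
  · simp [dcat, List.replicate_succ]

theorem DEqv.absorb [Finite A] {n m : ℕ} {b : Bool} {s u v : List A}
    (hu : ∀ a ∈ u, a ∈ s) (hv : ∀ a ∈ v, a ∈ s) (h : DEqv n (!b) m u v) (t : List A) :
    DEqv n b (m + 1) (dcat b t (dcat b (List.replicate n s).flatten u))
      (dcat b t (dcat b (List.replicate n s).flatten v)) := by
  induction n generalizing t with
  | zero => trivial
  | succ n ih =>
    have hrefl := (DEqv.equivalence (A := A) n (!b) m).refl
    refine ⟨fun a => ?_, ?_, ?_⟩
    · have h₁ := hu a
      have h₂ := hv a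
      simp only [mem_dcat, ← dcat_flatten_replicate b s n]
      tauto
    · exact .cat _ (hrefl _) (.cat _ (hrefl _) h.mono)
    · intro a p q p' q' hs hs'
      rw [← dcat_flatten_replicate b s n, dcat_assoc, ← dcat_assoc b t] at hs hs'
      have ha : a ∈ dcat b t s := by
        by_contra hcon
        have h₁ := hu a
        have h₂ := hs.mem
        simp only [mem_dcat, List.mem_flatten, List.mem_replicate] at h₁ h₂ hcon
        grind
      obtain ⟨p₀, r, h₀⟩ := exists_dsplit b ha
      obtain ⟨rfl, rfl⟩ := hs.unique (h₀.cat_right _)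
      obtain ⟨rfl, rfl⟩ := hs'.unique (h₀.cat_right _)
      exact ⟨hrefl _, ih h.mono r⟩

/-- `t` is a word over the letters of `s` in which every short word over these letters occurs
as a subword. -/
def Rich (s : List A) (n : ℕ) (t : List A) : Prop :=
  (∀ a ∈ t, a ∈ s) ∧ ∀ w : List A, (∀ a ∈ w, a ∈ s) → w.length ≤ n → w.Sublist t

theorem sublist_of_dcat_sublist_dsplit {b : Bool} {t p q w : List A} {a : A}
    (h : DSplit b t p a q) (hw : (dcat b [a] w).Sublist t) : w.Sublist q := by
  obtain ⟨rfl, hp⟩ := h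
  have key : ∀ {p q w : List A}, a ∉ p → (a :: w).Sublist (p ++ a :: q) → w.Sublist q := by
    intro p q w hp hw
    induction p with
    | nil => simpa using hw
    | cons x p ih =>
      simp only [List.mem_cons, not_or] at hp
      rw [List.cons_append] at hw
      cases hw with
      | cons _ h => exact ih hp.2 h
      | cons_cons _ h => exact absurd rfl hp.1
  cases b
  · have := hw.reverse
    simp only [dcat, cond_false, List.reverse_append, List.reverse_cons,
      List.reverse_nil, List.nil_append, List.append_assoc, List.cons_append] at this
    simpa using (key (by simpa using hp) this)
  · exact key hp hw

theorem DEqv.of_rich {n : ℕ} {b : Bool} {s t t' : List A} (h : Rich s n t) (h' : Rich s n t') :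
    DEqv n b 1 t t' := by
  induction n generalizing t t' with
  | zero => trivial
  | succ n ih =>
    have alph : ∀ {t}, Rich s (n + 1) t → ∀ a, a ∈ t ↔ a ∈ s := fun {t} h a =>
      ⟨h.1 a, fun ha => (h.2 [a] (by simpa using ha) (by simp)).subset (by simp)⟩
    have inner : ∀ {t p a q}, Rich s (n + 1) t → DSplit b t p a q → Rich s n q := by
      intro t p a q h hs
      refine ⟨fun c hc => h.1 c (by simp [hs.1, hc]), fun w hw hl => ?_⟩
      refine sublist_of_dcat_sublist_dsplit hs (h.2 _ ?_ ?_)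
      · intro c hc
        simp only [mem_dcat, List.mem_singleton] at hc
        rcases hc with rfl | hc
        · exact h.1 _ hs.mem
        · exact hw c hc
      · cases b <;> simp [dcat, hl]
    exact ⟨fun a => by rw [alph h, alph h'], DEqv.zero_right _ _ _ _,
      fun a p q p' q' hs hs' => ⟨DEqv.zero_right _ _ _ _, ih (inner h hs) (inner h' hs')⟩⟩

theorem rich_flatten_replicate (s : List A) (n : ℕ) :
    Rich s n (List.replicate n s).flatten := by
  refine ⟨fun a ha => by simp at ha; grind, ?_⟩
  induction n with
  | zero => intro w _ hw; simp_all
  | succ n ih =>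
    intro w hw hl
    cases w with
    | nil => simp
    | cons a w =>
      rw [List.replicate_succ, List.flatten_cons, ← List.singleton_append]
      refine List.Sublist.append (by simpa using hw a (by simp)) (ih w ?_ ?_)
      · exact fun c hc => hw c (by simp [hc])
      · simpa using hl

theorem Rich.append_left {s t : List A} {n : ℕ} (h : Rich s n t) {u : List A}
    (hu : ∀ a ∈ u, a ∈ s) : Rich s n (u ++ t) :=
  ⟨fun a ha => (List.mem_append.1 ha).elim (hu a) (h.1 a),
    fun w hw hl => (h.2 w hw hl).trans (List.sublist_append_right _ _)⟩

theorem Rich.append_right {s t : List A} {n : ℕ} (h : Rich s n t) {u : List A}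
    (hu : ∀ a ∈ u, a ∈ s) : Rich s n (t ++ u) :=
  ⟨fun a ha => (List.mem_append.1 ha).elim (h.1 a) (hu a),
    fun w hw hl => (h.2 w hw hl).trans (List.sublist_append_left _ _)⟩

theorem DEqv.outer {n m : ℕ} {b : Bool} {u v p q p' q' : List A} {a : A}
    (h : DEqv (n + 1) b (m + 2) u v) (hs : DSplit b u p a q) (hs' : DSplit b v p' a q') :
    DEqv n b (m + 2) p p' := by
  induction n generalizing u v p p' with
  | zero => trivial
  | succ n ih =>
    have hp := (h.2.2 a p q p' q' hs hs').1
    refine ⟨hp.1, hp.mono, ?_⟩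
    intro c x y x' y' hc hc'
    have h₁ := h.2.2 c _ _ _ _ (show DSplit b u x c (dcat b y (dcat b [a] q)) from
        ⟨by rw [hs.1, hc.1]; simp only [dcat_assoc], hc.2⟩)
      (show DSplit b v x' c (dcat b y' (dcat b [a] q')) from
        ⟨by rw [hs'.1, hc'.1]; simp only [dcat_assoc], hc'.2⟩)
    refine ⟨h₁.1.mono, ih h₁.2 ⟨rfl, fun ha => hs.2 ?_⟩ ⟨rfl, fun ha => hs'.2 ?_⟩⟩
    · simp [hc.1, ha]
    · simp [hc'.1, ha]

theorem DEqv.mem_inner {n m : ℕ} {b : Bool} {u v p q p' q' : List A} {a : A}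
    (h : DEqv (n + 2) b (m + 1) u v) (hs : DSplit (!b) u p a q) (hs' : DSplit (!b) v p' a q')
    {c : A} (hc : c ∈ q) : c ∈ q' := by
  obtain ⟨x, y, hx⟩ := exists_dsplit b hc
  obtain ⟨x', z, hx'⟩ := exists_dsplit b ((h.1 c).1 (by simp [hs.1, hc]))
  have h₁ := (h.2.2 c _ _ _ _ (show DSplit b u x c (dcat b y (dcat b [a] p)) from
    ⟨by rw [hs.1, hx.1]; simp only [dcat_not, dcat_assoc], hx.2⟩) hx').2
  obtain ⟨z₂, z₁, hz⟩ := exists_dsplit (!b) ((h₁.1 a).1 (by simp))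
  have := (hs'.unique (show DSplit (!b) v z₂ a (dcat b x' (dcat b [c] z₁)) from
    ⟨by rw [hx'.1, hz.1]; simp only [dcat_not, dcat_assoc], hz.2⟩)).2
  simp [this]

theorem DEqv.inner [Finite A] {n m : ℕ} {b : Bool} {u v p q p' q' : List A} {a : A}
    (h : DEqv (n + 1) b (m + 1) u v) (hs : DSplit (!b) u p a q) (hs' : DSplit (!b) v p' a q') :
    DEqv n b (m + 1) q q' := by
  induction n generalizing u v q q' with
  | zero => trivial
  | succ n ih =>
    refine ⟨fun c => ⟨h.mem_inner hs hs',
      ((DEqv.equivalence _ _ _).symm h).mem_inner hs' hs⟩, ?_, ?_⟩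
    · cases m with
      | zero => exact DEqv.zero_right _ _ _ _
      | succ m => exact (h.2.1.2.2 a p q p' q' hs hs').2
    · intro c x y x' y' hc hc'
      have h₁ := h.2.2 c _ _ _ _ (show DSplit b u x c (dcat b y (dcat b [a] p)) from
          ⟨by rw [hs.1, hc.1]; simp only [dcat_not, dcat_assoc], hc.2⟩)
        (show DSplit b v x' c (dcat b y' (dcat b [a] p')) from
          ⟨by rw [hs'.1, hc'.1]; simp only [dcat_not, dcat_assoc], hc'.2⟩)
      refine ⟨h₁.1.mono, ih h₁.2 ⟨?_, hs.2⟩ ⟨?_, hs'.2⟩⟩ <;>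
        simp only [dcat_not, dcat_assoc]

/-- In reading direction `b`, the last `c` of `u` precedes its first `a`, and `r` is the factor
between them. -/
def DBetween (b : Bool) (u p : List A) (c : A) (r : List A) (a : A) (q : List A) : Prop :=
  u = dcat b p (dcat b [c] (dcat b r (dcat b [a] q))) ∧
    a ∉ p ∧ a ∉ r ∧ a ≠ c ∧ c ∉ q ∧ c ∉ r

theorem DBetween.not {b : Bool} {u p r q : List A} {a c : A} (h : DBetween b u p c r a q) :
    DBetween (!b) u q a r c p := by
  obtain ⟨h, h₁, h₂, h₃, h₄, h₅⟩ := h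
  exact ⟨by rw [h]; simp only [dcat_not, dcat_assoc], h₄, h₅, h₃.symm, h₁, h₂⟩

theorem DEqv.between {n m : ℕ} {b : Bool} {u v p r q : List A} {a c : A}
    (h : DEqv (n + 2) b (m + 2) u v) (hu : DBetween b u p c r a q) :
    ∃ p' r' q', DBetween b v p' c r' a q' ∧ (m = 0 ∨ DEqv n (!b) (m + 1) r r') := by
  obtain ⟨rfl, h₁, h₂, h₃, h₄, h₅⟩ := hu
  have hs : DSplit b (dcat b p (dcat b [c] (dcat b r (dcat b [a] q))))
      (dcat b p (dcat b [c] r)) a q :=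
    ⟨by simp only [dcat_assoc], by simp [h₁, h₂, h₃]⟩
  obtain ⟨x', q', hs'⟩ := exists_dsplit b ((h.1 a).1 hs.mem)
  obtain ⟨hx, hq⟩ := h.2.2 a _ _ _ _ hs hs'
  obtain ⟨r', p', hr'⟩ := exists_dsplit (!b) ((hx.1 c).1 (by simp))
  have hx' : x' = dcat b p' (dcat b [c] r') := by
    rw [hr'.1]; simp only [dcat_not, dcat_assoc]
  have ha := hs'.2
  simp only [hx', mem_dcat, List.mem_singleton, not_or] at ha
  refine ⟨p', r', q', ⟨?_, ha.1, ha.2.2, ha.2.1, fun hc => h₄ ((hq.1 c).2 hc), hr'.2⟩, ?_⟩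
  · rw [hs'.1, hx']; simp only [dcat_assoc]
  · cases m with
    | zero => exact .inl rfl
    | succ m =>
      refine .inr (hx.outer (a := c) (q := p) ⟨?_, h₅⟩ hr')
      simp only [dcat_not, dcat_assoc]

end Directed

/-! ## Generalized words represented by finite words -/

namespace GWord

variable {A : Type}

/-- The generalized word `U` is isomorphic to the finite word `l`. -/
def Rep (U : GWord A) (l : List A) : Prop :=
  ∃ L : List U.P, L.Pairwise (· < ·) ∧ (∀ p, p ∈ L) ∧ L.map U.w = l

theorem rep_ofList (l : List A) : (ofList l).Rep l :=
  ⟨List.finRange l.length, List.pairwise_lt_finRange _, List.mem_finRange,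
    List.map_get_finRange l⟩

theorem rep_restrict {U : GWord A} {L : List U.P} (hL : L.Pairwise (· < ·)) {s : Set U.P}
    (hs : ∀ p, p ∈ s ↔ p ∈ L) : (U.restrict s).Rep (L.map U.w) := by
  let f : ∀ p, p ∈ s → (U.restrict s).P := fun p hp => ⟨p, hp⟩
  refine ⟨L.pmap f fun p hp => (hs p).2 hp, ?_, ?_, ?_⟩
  · rw [List.pairwise_pmap]
    exact hL.imp fun h _ _ => h
  · rintro ⟨p, hp⟩
    exact List.mem_pmap.2 ⟨p, (hs p).1 hp, rfl⟩
  · rw [List.map_pmap]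
    exact List.pmap_eq_map (f := U.w) _

theorem Rep.mem_alph {U : GWord A} {l : List A} (h : U.Rep l) {a : A} :
    a ∈ U.alph ↔ a ∈ l := by
  obtain ⟨L, -, hm, rfl⟩ := h
  simp [alph, hm]

theorem IsFirst.unique {U : GWord A} {a : A} {p q : U.P} (hp : U.IsFirst a p)
    (hq : U.IsFirst a q) : p = q := le_antisymm (hp.2 q hq.1) (hq.2 p hp.1)

theorem IsLast.unique {U : GWord A} {a : A} {p q : U.P} (hp : U.IsLast a p)
    (hq : U.IsLast a q) : p = q := le_antisymm (hq.2 p hp.1) (hp.2 q hq.1)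

theorem isFirst_of_split {U : GWord A} {L₁ L₂ : List U.P} {x : U.P}
    (hL : (L₁ ++ x :: L₂).Pairwise (· < ·)) (hm : ∀ p, p ∈ L₁ ++ x :: L₂)
    (h : U.w x ∉ L₁.map U.w) : U.IsFirst (U.w x) x := by
  refine ⟨rfl, fun y hy => ?_⟩
  simp only [List.pairwise_append, List.pairwise_cons] at hL
  have := hm y
  simp only [List.mem_append, List.mem_cons] at this
  rcases this with h₁ | rfl | h₁
  · exact absurd (hy ▸ List.mem_map_of_mem h₁) h
  · exact le_rfl
  · exact (hL.2.1.1 y h₁).le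

theorem isLast_of_split {U : GWord A} {L₁ L₂ : List U.P} {x : U.P}
    (hL : (L₁ ++ x :: L₂).Pairwise (· < ·)) (hm : ∀ p, p ∈ L₁ ++ x :: L₂)
    (h : U.w x ∉ L₂.map U.w) : U.IsLast (U.w x) x := by
  refine ⟨rfl, fun y hy => ?_⟩
  simp only [List.pairwise_append, List.pairwise_cons] at hL
  have := hm y
  simp only [List.mem_append, List.mem_cons] at this
  rcases this with h₁ | rfl | h₁
  · exact (hL.2.2 y h₁ x (by simp)).le
  · exact le_rfl
  · exact absurd (hy ▸ List.mem_map_of_mem h₁) h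

theorem rep_restrict_split {U : GWord A} {L₁ L₂ : List U.P} {x : U.P}
    (hL : (L₁ ++ x :: L₂).Pairwise (· < ·)) (hm : ∀ p, p ∈ L₁ ++ x :: L₂) :
    (U.restrict {q | q < x}).Rep (L₁.map U.w) ∧
      (U.restrict {q | x < q}).Rep (L₂.map U.w) := by
  simp only [List.pairwise_append, List.pairwise_cons] at hL
  obtain ⟨h₁, ⟨h₂, h₃⟩, h₄⟩ := hL
  simp only [List.mem_append, List.mem_cons] at hm
  have h₅ : ∀ p ∈ L₁, p < x := fun p hp => h₄ p hp x (by simp)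
  refine ⟨rep_restrict h₁ fun p => ⟨fun hp => ?_, h₅ p⟩,
    rep_restrict h₃ fun p => ⟨fun hp => ?_, h₂ p⟩⟩
  · rcases hm p with h | rfl | h
    · exact h
    · exact absurd hp (lt_irrefl _)
    · exact absurd (h₂ p h) (lt_asymm hp)
  · rcases hm p with h | rfl | h
    · exact absurd (h₅ p h) (lt_asymm hp)
    · exact absurd hp (lt_irrefl _)
    · exact h

theorem Rep.first {U : GWord A} {u p q : List A} {a : A} (h : U.Rep u)
    (hs : DSplit true u p a q) : (U.XL a).Rep p ∧ (U.XR a).Rep q := by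
  obtain ⟨L, hL, hm, rfl⟩ := h
  obtain ⟨he, ha⟩ := hs
  obtain ⟨L₁, L', rfl, rfl, h'⟩ := List.map_eq_append_iff.1 he
  obtain ⟨x, L₂, rfl, rfl, rfl⟩ := List.map_eq_cons_iff.1 h'
  have hx := isFirst_of_split hL hm ha
  have hex : ∃ p, U.IsFirst (U.w x) p := ⟨x, hx⟩
  rw [XL, XR, dif_pos hex, dif_pos hex, hex.choose_spec.unique hx]
  exact rep_restrict_split hL hm

theorem Rep.last {U : GWord A} {u p q : List A} {a : A} (h : U.Rep u)
    (hs : DSplit false u p a q) : (U.YR a).Rep p ∧ (U.YL a).Rep q := by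
  obtain ⟨L, hL, hm, rfl⟩ := h
  obtain ⟨he, ha⟩ := hs
  simp only [dcat, cond_false, List.append_assoc, List.singleton_append] at he
  obtain ⟨L₁, L', rfl, rfl, h'⟩ := List.map_eq_append_iff.1 he
  obtain ⟨x, L₂, rfl, rfl, rfl⟩ := List.map_eq_cons_iff.1 h'
  have hx := isLast_of_split hL hm ha
  have hex : ∃ p, U.IsLast (U.w x) p := ⟨x, hx⟩
  rw [YL, YR, dif_pos hex, dif_pos hex, hex.choose_spec.unique hx]
  exact (rep_restrict_split hL hm).symm

theorem Rep.between {U : GWord A} {u p r q : List A} {a c : A} (h : U.Rep u)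
    (hb : DBetween true u p c r a q) : U.CDefined a c ∧ (U.Cab a c).Rep r := by
  obtain ⟨L, hL, hm, rfl⟩ := h
  obtain ⟨he, h₁, h₂, h₃, h₄, h₅⟩ := hb
  simp only [dcat, cond_true, List.singleton_append] at he
  obtain ⟨L₁, L', rfl, rfl, h'⟩ := List.map_eq_append_iff.1 he
  obtain ⟨y, L'', rfl, rfl, h''⟩ := List.map_eq_cons_iff.1 h'
  obtain ⟨L₂, L''', rfl, rfl, h'''⟩ := List.map_eq_append_iff.1 h''
  obtain ⟨x, L₃, rfl, rfl, rfl⟩ := List.map_eq_cons_iff.1 h'''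
  have hy := isLast_of_split hL hm (by simpa using ⟨by simpa using h₅, h₃.symm, by simpa using h₄⟩)
  have hx : U.IsFirst (U.w x) x := by
    have he : L₁ ++ y :: (L₂ ++ x :: L₃) = (L₁ ++ y :: L₂) ++ x :: L₃ := by simp
    rw [he] at hL hm
    exact isFirst_of_split hL hm (by simpa using ⟨by simpa using h₁, h₃, by simpa using h₂⟩)
  simp only [List.pairwise_append, List.pairwise_cons, List.mem_append, List.mem_cons] at hL hm
  have hd : U.CDefined (U.w x) (U.w y) := ⟨x, y, hx, hy, hL.2.1.1 x (by simp)⟩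
  refine ⟨hd, ?_⟩
  rw [Cab, dif_pos hd, hd.choose_spec.choose_spec.2.1.unique hy,
    hd.choose_spec.choose_spec.1.unique hx]
  refine rep_restrict hL.2.1.2.1 fun z => ⟨fun hz => ?_, fun hz =>
    ⟨hL.2.1.1 z (by simp [hz]), hL.2.1.2.2.2 z hz x (by simp)⟩⟩
  rcases hm z with h | rfl | h | rfl | h
  · exact absurd (hL.2.2 z h y (by simp)) (lt_asymm hz.1)
  · exact absurd hz.1 (lt_irrefl _)
  · exact h
  · exact absurd hz.2 (lt_irrefl _)
  · exact absurd (hL.2.1.2.2.1.1 z h) (lt_asymm hz.2)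

theorem Rep.exists_between {U : GWord A} {u : List A} {a c : A} (h : U.Rep u)
    (hd : U.CDefined a c) : ∃ p r q, DBetween true u p c r a q := by
  obtain ⟨L, hL, hm, rfl⟩ := h
  obtain ⟨x, y, ⟨rfl, hx⟩, ⟨rfl, hy⟩, hlt⟩ := hd
  obtain ⟨L₁, L', rfl⟩ := List.append_of_mem (hm y)
  have hL' := hL
  simp only [List.pairwise_append, List.pairwise_cons, List.mem_append, List.mem_cons] at hL' hm
  have hxm : x ∈ L' := by
    rcases hm x with h | rfl | h
    · exact absurd (hL'.2.2 x h y (by simp)) (lt_asymm hlt)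
    · exact absurd hlt (lt_irrefl _)
    · exact h
  obtain ⟨L₂, L₃, rfl⟩ := List.append_of_mem hxm
  simp only [List.pairwise_append, List.pairwise_cons, List.mem_append, List.mem_cons] at hL'
  refine ⟨L₁.map U.w, L₂.map U.w, L₃.map U.w, by simp [dcat], ?_, ?_, ?_, ?_, ?_⟩
  · rintro hz
    obtain ⟨z, hz, he⟩ := List.mem_map.1 hz
    exact absurd (hx z he) (not_le.2 ((hL'.2.2 z hz y (by simp)).trans hlt))
  · rintro hz
    obtain ⟨z, hz, he⟩ := List.mem_map.1 hz
    exact absurd (hx z he) (not_le.2 (hL'.2.1.2.2.2 z hz x (by simp)))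
  · exact fun he => absurd (hx y he.symm) (not_le.2 hlt)
  · rintro hz
    obtain ⟨z, hz, he⟩ := List.mem_map.1 hz
    exact absurd (hy z he) (not_le.2 (hL'.2.1.1 z (by simp [hz])))
  · rintro hz
    obtain ⟨z, hz, he⟩ := List.mem_map.1 hz
    exact absurd (hy z he) (not_le.2 (hL'.2.1.1 z (by simp [hz])))

end GWord

section Comparison

variable {A : Type}

open GWord

theorem eqvAux_iff_dEqv {n : ℕ} {b : Bool} {m : ℕ} {U V : GWord A} {u v : List A}
    (hU : U.Rep u) (hV : V.Rep v) :
    eqvAux n (bif b then ZK.X else ZK.Y) m U V ↔ DEqv n b m u v := by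
  induction n generalizing b m U V u v with
  | zero => simp [eqvAux, DEqv]
  | succ n ih =>
    cases m with
    | zero => cases b <;> simp [eqvAux]
    | succ m =>
      have halph : U.alph = V.alph ↔ ∀ a, a ∈ u ↔ a ∈ v := by
        simp only [Set.ext_iff, hU.mem_alph, hV.mem_alph]
      cases b
      · simp only [cond_false, eqvAux, DEqv, halph]
        refine and_congr_right fun he => and_congr (ih (b := true) hU hV) ⟨?_, ?_⟩
        · intro H a p q p' q' hs hs'
          obtain ⟨h₁, h₂⟩ := H a (hU.mem_alph.2 hs.mem)
          exact ⟨(ih (b := true) (hU.last hs).1 (hV.last hs').1).1 h₂,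
            (ih (b := false) (hU.last hs).2 (hV.last hs').2).1 h₁⟩
        · intro H a ha
          have ha := hU.mem_alph.1 ha
          obtain ⟨p, q, hs⟩ := exists_dsplit false ha
          obtain ⟨p', q', hs'⟩ := exists_dsplit false ((he a).1 ha)
          obtain ⟨h₁, h₂⟩ := H a p q p' q' hs hs'
          exact ⟨(ih (b := false) (hU.last hs).2 (hV.last hs').2).2 h₂,
            (ih (b := true) (hU.last hs).1 (hV.last hs').1).2 h₁⟩
      · simp only [cond_true, eqvAux, DEqv, halph]
        refine and_congr_right fun he => and_congr (ih (b := false) hU hV) ⟨?_, ?_⟩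
        · intro H a p q p' q' hs hs'
          obtain ⟨h₁, h₂⟩ := H a (hU.mem_alph.2 hs.mem)
          exact ⟨(ih (b := false) (hU.first hs).1 (hV.first hs').1).1 h₁,
            (ih (b := true) (hU.first hs).2 (hV.first hs').2).1 h₂⟩
        · intro H a ha
          have ha := hU.mem_alph.1 ha
          obtain ⟨p, q, hs⟩ := exists_dsplit true ha
          obtain ⟨p', q', hs'⟩ := exists_dsplit true ((he a).1 ha)
          obtain ⟨h₁, h₂⟩ := H a p q p' q' hs hs'
          exact ⟨(ih (b := false) (hU.first hs).1 (hV.first hs').1).2 h₁,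
            (ih (b := true) (hU.first hs).2 (hV.first hs').2).2 h₂⟩

@[simp] theorem eqvAux_zero_right (n : ℕ) (Z : ZK) (U V : GWord A) : eqvAux n Z 0 U V := by
  cases n <;> simp [eqvAux]

theorem DEqv.between_true {n m : ℕ} {b : Bool} {u v p r q : List A} {a c : A}
    (h : DEqv (n + 2) b (m + 2) u v) (hu : DBetween true u p c r a q) :
    ∃ p' r' q', DBetween true v p' c r' a q' ∧ (m = 0 ∨ DEqv n (!b) (m + 1) r r') := by
  cases b
  · obtain ⟨p', r', q', hv, hr⟩ := h.between hu.not
    exact ⟨q', r', p', hv.not, hr⟩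
  · exact h.between hu

theorem DEqv.eqvAux_WI [Finite A] {n m : ℕ} {b : Bool} {U V : GWord A} {u v : List A}
    (hU : U.Rep u) (hV : V.Rep v) (h : DEqv (2 * n) b (m + 1) u v) :
    eqvAux n ZK.WI m U V := by
  induction n generalizing b m U V u v with
  | zero => simp [eqvAux]
  | succ n ih =>
    cases m with
    | zero => simp
    | succ m =>
      rw [show 2 * (n + 1) = 2 * n + 2 by ring] at h
      have hsymm := (DEqv.equivalence (A := A) (2 * n + 2) b (m + 2)).symm h
      have outer : ∀ {c : Bool} {a p q p' q' U' V'}, DSplit c u p a q → DSplit c v p' a q' →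
          U'.Rep p → V'.Rep p' → eqvAux n ZK.WI m U' V' := by
        intro c a p q p' q' U' V' hs hs' hU' hV'
        rcases Bool.eq_or_eq_not c b with rfl | rfl
        · exact ih hU' hV' (h.2.2 _ _ _ _ _ hs hs').1.mono
        · cases m with
          | zero => simp
          | succ m => exact ih hU' hV' (h.2.1.outer hs hs')
      have inner : ∀ {c : Bool} {a p q p' q' U' V'}, DSplit c u p a q → DSplit c v p' a q' →
          U'.Rep q → V'.Rep q' → eqvAux n ZK.WI (m + 1) U' V' := by
        intro c a p q p' q' U' V' hs hs' hU' hV'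
        rcases Bool.eq_or_eq_not c b with rfl | rfl
        · exact ih hU' hV' (h.2.2 _ _ _ _ _ hs hs').2.mono
        · exact ih hU' hV' (h.inner hs hs').mono
      refine ⟨?_, ?_, ?_⟩
      · simp only [Set.ext_iff, hU.mem_alph, hV.mem_alph]
        exact h.1
      · intro a ha
        have ha := hU.mem_alph.1 ha
        have ha' := (h.1 a).1 ha
        obtain ⟨p, q, hs⟩ := exists_dsplit true ha
        obtain ⟨p', q', hs'⟩ := exists_dsplit true ha'
        obtain ⟨x, y, ht⟩ := exists_dsplit false ha
        obtain ⟨x', y', ht'⟩ := exists_dsplit false ha'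
        exact ⟨outer hs hs' (hU.first hs).1 (hV.first hs').1,
          inner hs hs' (hU.first hs).2 (hV.first hs').2,
          inner ht ht' (hU.last ht).2 (hV.last ht').2,
          outer ht ht' (hU.last ht).1 (hV.last ht').1⟩
      · intro a _ c _
        refine ⟨⟨fun hd => ?_, fun hd => ?_⟩, fun hd _ => ?_⟩
        · obtain ⟨p, r, q, hb⟩ := hU.exists_between hd
          obtain ⟨p', r', q', hb', -⟩ := h.between_true hb
          exact (hV.between hb').1
        · obtain ⟨p, r, q, hb⟩ := hV.exists_between hd
          obtain ⟨p', r', q', hb', -⟩ := hsymm.between_true hb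
          exact (hU.between hb').1
        · obtain ⟨p, r, q, hb⟩ := hU.exists_between hd
          obtain ⟨p', r', q', hb', rfl | hr⟩ := h.between_true hb
          · simp
          · exact ih (hU.between hb).2 (hV.between hb').2 hr

end Comparison

/-! ## Closure of the Trotter–Weil hierarchy under quotients -/

section Quotients

theorem exists_pow_isIdempotentElem {M : Type*} [Monoid M] [Finite M] (x : M) :
    ∃ k, IsIdempotentElem (x ^ (k + 1)) := by
  obtain ⟨i, j, hij, he⟩ : ∃ i j, i < j ∧ x ^ i = x ^ j := by
    obtain ⟨i, j, hij, he⟩ := Finite.exists_ne_map_eq_of_infinite fun n : ℕ => x ^ n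
    rcases lt_or_gt_of_ne hij with h | h
    · exact ⟨i, j, h, he⟩
    · exact ⟨j, i, h, he.symm⟩
  obtain ⟨d, rfl⟩ := Nat.exists_eq_add_of_lt hij
  have shift : ∀ s, x ^ (i + s) = x ^ (i + s + (d + 1)) := fun s => by
    rw [show i + s + (d + 1) = i + d + 1 + s by ring, pow_add x (i + d + 1), ← he, pow_add]
  have shifts : ∀ s t, x ^ (i + s) = x ^ (i + s + t * (d + 1)) := fun s t => by
    induction t with
    | zero => simp
    | succ t ih =>
      rw [ih, add_assoc i s, shift]
      congr 1
      ring
  refine ⟨i + ((i + 1) * d), ?_⟩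
  have := shifts ((i + 1) * d + 1) (i + 1)
  rw [IsIdempotentElem, ← pow_add]
  convert this.symm using 2 <;> ring

variable {M N : Type} [Monoid M] [Monoid N]

theorem rGreen_mul_iff {e x : M} : rGreen (e * x) e ↔ ∃ z, e * x * z = e := by
  refine ⟨fun h => ?_, fun ⟨z, hz⟩ => ?_⟩
  · have : e ∈ Set.range (fun z => e * z) := ⟨1, mul_one e⟩
    rwa [← h] at this
  · refine Set.Subset.antisymm ?_ ?_
    · rintro _ ⟨y, rfl⟩
      exact ⟨x * y, (mul_assoc _ _ _).symm⟩
    · rintro _ ⟨y, rfl⟩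
      exact ⟨z * y, by simp only [← mul_assoc, hz]⟩

theorem lGreen_mul_iff {e x : M} : lGreen (x * e) e ↔ ∃ z, z * (x * e) = e := by
  refine ⟨fun h => ?_, fun ⟨z, hz⟩ => ?_⟩
  · have : e ∈ Set.range (fun z => z * e) := ⟨1, one_mul e⟩
    rwa [← h] at this
  · refine Set.Subset.antisymm ?_ ?_
    · rintro _ ⟨y, rfl⟩
      exact ⟨y * x, mul_assoc _ _ _⟩
    · rintro _ ⟨y, rfl⟩
      exact ⟨y * z, by simp only [mul_assoc, hz]⟩

theorem exists_isIdempotentElem_map_eq [Finite M] {f : M →* N} (hf : Function.Surjective f)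
    {e : N} (he : IsIdempotentElem e) : ∃ s : M, IsIdempotentElem s ∧ f s = e := by
  obtain ⟨s, rfl⟩ := hf e
  obtain ⟨k, hk⟩ := exists_pow_isIdempotentElem s
  exact ⟨_, hk, by rw [map_pow, he.pow_succ_eq]⟩

theorem exists_isIdempotentElem_rGreen [Finite M] {f : M →* N} (hf : Function.Surjective f)
    {e : N} (he : IsIdempotentElem e) {x : M} (h : rGreen (e * f x) e) :
    ∃ g : M, IsIdempotentElem g ∧ f g = e ∧ rGreen (g * x) g := by
  obtain ⟨z, hz⟩ := rGreen_mul_iff.1 h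
  obtain ⟨s, hs, rfl⟩ := exists_isIdempotentElem_map_eq hf he
  obtain ⟨z, rfl⟩ := hf z
  obtain ⟨k, hk⟩ := exists_pow_isIdempotentElem (s * x * z * s)
  have hgs : (s * x * z * s) ^ (k + 1) * s = (s * x * z * s) ^ (k + 1) := by
    rw [pow_succ, mul_assoc, mul_assoc (s * x * z) s s, hs.eq]
  refine ⟨_, hk, ?_, rGreen_mul_iff.2 ⟨z * s * (s * x * z * s) ^ k, ?_⟩⟩
  · rw [map_pow, map_mul, map_mul, map_mul, hz, he.eq, he.pow_succ_eq]
  · calc _ = (s * x * z * s) ^ (k + 1) * s * x * z * s * (s * x * z * s) ^ k := by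
          rw [hgs]; simp only [mul_assoc]
      _ = (s * x * z * s) ^ (k + 1) * (s * x * z * s) ^ (k + 1) := by
          rw [pow_succ' _ k]; simp only [mul_assoc]
      _ = _ := hk.eq

theorem exists_isIdempotentElem_lGreen [Finite M] {f : M →* N} (hf : Function.Surjective f)
    {e : N} (he : IsIdempotentElem e) {x : M} (h : lGreen (f x * e) e) :
    ∃ g : M, IsIdempotentElem g ∧ f g = e ∧ lGreen (x * g) g := by
  obtain ⟨z, hz⟩ := lGreen_mul_iff.1 h
  obtain ⟨s, hs, rfl⟩ := exists_isIdempotentElem_map_eq hf he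
  obtain ⟨z, rfl⟩ := hf z
  obtain ⟨k, hk⟩ := exists_pow_isIdempotentElem (s * (z * (x * s)))
  have hgs : s * (s * (z * (x * s))) ^ (k + 1) = (s * (z * (x * s))) ^ (k + 1) := by
    rw [pow_succ', ← mul_assoc, ← mul_assoc s s, hs.eq]
  refine ⟨_, hk, ?_, lGreen_mul_iff.2 ⟨(s * (z * (x * s))) ^ k * (s * z), ?_⟩⟩
  · rw [map_pow, map_mul, map_mul, map_mul, hz, he.eq, he.pow_succ_eq]
  · calc _ = (s * (z * (x * s))) ^ k * (s * (z * (x * (s * (s * (z * (x * s))) ^ (k + 1))))) := by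
          rw [hgs]; simp only [mul_assoc]
      _ = (s * (z * (x * s))) ^ (k + 1) * (s * (z * (x * s))) ^ (k + 1) := by
          rw [pow_succ _ k]; simp only [mul_assoc]
      _ = _ := hk.eq

theorem simK_map [Finite M] {f : M →* N} (hf : Function.Surjective f) {x y : M}
    (h : simK x y) : simK (f x) (f y) := by
  rintro e he (hx | hy)
  · obtain ⟨g, hg, rfl, hgx⟩ := exists_isIdempotentElem_rGreen hf he hx
    rw [← map_mul, ← map_mul, h g hg (.inl hgx)]
  · obtain ⟨g, hg, rfl, hgy⟩ := exists_isIdempotentElem_rGreen hf he hy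
    rw [← map_mul, ← map_mul, h g hg (.inr hgy)]

theorem simD_map [Finite M] {f : M →* N} (hf : Function.Surjective f) {x y : M}
    (h : simD x y) : simD (f x) (f y) := by
  rintro e he (hx | hy)
  · obtain ⟨g, hg, rfl, hgx⟩ := exists_isIdempotentElem_lGreen hf he hx
    rw [← map_mul, ← map_mul, h g hg (.inl hgx)]
  · obtain ⟨g, hg, rfl, hgy⟩ := exists_isIdempotentElem_lGreen hf he hy
    rw [← map_mul, ← map_mul, h g hg (.inr hgy)]

theorem Con.exists_surjective_of_le {M P : Type*} [Monoid M] [Monoid P] {c : Con M}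
    {g : M →* P} (hg : Function.Surjective g) (h : ∀ x y, c x y → g x = g y) :
    ∃ f : c.Quotient →* P, Function.Surjective f :=
  ⟨c.lift g fun {x y} hxy => h x y hxy, Con.lift_surjective_of_surjective _ hg⟩

theorem Con.exists_surjective_conGen {M P : Type*} [Monoid M] [Monoid P] {r : M → M → Prop}
    {g : M →* P} (hg : Function.Surjective g) (h : ∀ x y, r x y → g x = g y) :
    ∃ f : (conGen r).Quotient →* P, Function.Surjective f :=
  Con.exists_surjective_of_le hg fun _ _ hxy =>
    (Con.conGen_le (c := Con.ker g)).2 h hxy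

theorem IsJTrivial.eq_of_eq_mul (hM : IsJTrivial M) {x y a b c d : M} (hy : y = a * x * b)
    (hx : x = c * y * d) : x = y := by
  refine hM _ _ (Set.Subset.antisymm ?_ ?_)
  · rintro _ ⟨u, v, rfl⟩
    exact ⟨u * c, d * v, by rw [hx]; simp only [mul_assoc]⟩
  · rintro _ ⟨u, v, rfl⟩
    exact ⟨u * a, b * v, by rw [hy]; simp only [mul_assoc]⟩

theorem IsJTrivial.absorb [Finite M] (hM : IsJTrivial M) (a c : M) :
    ∃ k, ∀ j ≥ k, a * (c * a) ^ j = (c * a) ^ j ∧ (c * a) ^ j * c = (c * a) ^ j := by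
  obtain ⟨k, hk⟩ := exists_pow_isIdempotentElem (c * a)
  refine ⟨k + 1, fun j hj => ?_⟩
  obtain ⟨i, rfl⟩ := Nat.exists_eq_add_of_le hj
  have h : (c * a) ^ (k + 1 + i) = (c * a) ^ (k + 1 + (k + 1 + i)) := by
    rw [pow_add _ (k + 1) (k + 1 + i), pow_add _ (k + 1) i, ← mul_assoc, hk.eq]
  refine ⟨(hM.eq_of_eq_mul (a := a) (b := 1) (c := (c * a) ^ k * c) (d := 1) ?_ ?_).symm,
    (hM.eq_of_eq_mul (a := 1) (b := c) (c := 1) (d := a * (c * a) ^ k) ?_ ?_).symm⟩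
  · simp
  · conv_lhs => rw [h, pow_add, pow_succ]
    simp only [mul_assoc, mul_one]
  · simp
  · conv_lhs => rw [h, add_comm, pow_add, pow_succ']
    simp only [mul_assoc, one_mul]

theorem eq_pow_mul_mul_pow {x p q : M} (h : x = p * x * q) (k : ℕ) : x = p ^ k * x * q ^ k := by
  induction k with
  | zero => simp
  | succ k ih =>
    calc x = p ^ k * (p * x * q) * q ^ k := by rw [← h]; exact ih
      _ = _ := by rw [pow_succ p, pow_succ' q]; simp only [mul_assoc]

/-- A monoid is `J`-trivial as soon as powers absorb the factors of their base. -/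
theorem isJTrivial_of_absorb
    (h : ∀ a c : M, ∃ k, ∀ j ≥ k, a * (c * a) ^ j = (c * a) ^ j ∧ (c * a) ^ j * c = (c * a) ^ j) :
    IsJTrivial M := by
  intro x y hxy
  obtain ⟨a, b, hy⟩ : y ∈ {z | ∃ a b, z = a * x * b} := by
    rw [hxy]; exact ⟨1, 1, by simp⟩
  obtain ⟨c, d, hx⟩ : x ∈ {z | ∃ a b, z = a * y * b} := by
    rw [← hxy]; exact ⟨1, 1, by simp⟩
  have hx' : x = (c * a) * x * (b * d) := by
    conv_lhs => rw [hx, hy]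
    simp only [mul_assoc]
  obtain ⟨k, hk⟩ := h a c
  obtain ⟨l, hl⟩ := h d b
  have e := eq_pow_mul_mul_pow hx' (max k l)
  calc x = (c * a) ^ max k l * x * (b * d) ^ max k l := e
    _ = a * (c * a) ^ max k l * x * ((b * d) ^ max k l * b) := by
        rw [(hk _ (le_max_left _ _)).1, (hl _ (le_max_right _ _)).2]
    _ = a * ((c * a) ^ max k l * x * (b * d) ^ max k l) * b := by simp only [mul_assoc]
    _ = y := by rw [← e, hy]

theorem IsJTrivial.of_surjective [Finite M] (hM : IsJTrivial M) {f : M →* N}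
    (hf : Function.Surjective f) : IsJTrivial N := by
  refine isJTrivial_of_absorb fun a c => ?_
  obtain ⟨a, rfl⟩ := hf a
  obtain ⟨c, rfl⟩ := hf c
  obtain ⟨k, hk⟩ := hM.absorb a c
  refine ⟨k, fun j hj => ?_⟩
  simp only [← map_mul, ← map_pow, hk j hj, and_self]

theorem InRLAux.of_surjective (k : ℕ) (b : Bool) {M N : Type} [iM : Monoid M] [iN : Monoid N]
    [Finite M] {f : M →* N} (hf : Function.Surjective f) (hM : InRLAux k b M iM) :
    InRLAux k b N iN := by
  induction k generalizing b M N with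
  | zero => exact IsJTrivial.of_surjective (M := M) (by simpa only [InRLAux] using hM) hf
  | succ k ih =>
    cases b
    · obtain ⟨g, hg⟩ := Con.exists_surjective_conGen (r := simD (M := M))
        (g := (DCon N).mk'.comp f) ((DCon N).mk'_surjective.comp hf)
        fun x y h => (Con.eq _).2 (Con.le_conGen _ _ (simD_map hf h))
      have : Finite (conGen (simD (M := M))).Quotient :=
        Finite.of_surjective _ (Con.mk'_surjective (c := conGen (simD (M := M))))
      exact ih true hg hM
    · obtain ⟨g, hg⟩ := Con.exists_surjective_conGen (r := simK (M := M))
        (g := (KCon N).mk'.comp f) ((KCon N).mk'_surjective.comp hf)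
        fun x y h => (Con.eq _).2 (Con.le_conGen _ _ (simK_map hf h))
      have : Finite (conGen (simK (M := M))).Quotient :=
        Finite.of_surjective _ (Con.mk'_surjective (c := conGen (simK (M := M))))
      exact ih false hg hM

end Quotients

/-! ## The quotients of the free monoid -/

section FreeMonoidQuotients

variable (A : Type)

/-- The congruence `≡_{m,n}^X` (for `b = true`) or `≡_{m,n}^Y` (for `b = false`). -/
def dCon [Finite A] (b : Bool) (m n : ℕ) : Con (FreeMonoid A) where
  r u v := DEqv n b m u.toList v.toList
  iseqv := ⟨fun _ => (DEqv.equivalence n b m).refl _, (DEqv.equivalence n b m).symm,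
    (DEqv.equivalence n b m).trans⟩
  mul' h h' := DEqv.cat true h h'

theorem dCon_apply [Finite A] {b : Bool} {m n : ℕ} {u v : FreeMonoid A} :
    dCon A b m n u v ↔ DEqv n b m u.toList v.toList := Iff.rfl

theorem eqvCon_eq_dCon [Finite A] (b : Bool) (m n : ℕ) :
    eqvCon A (bif b then ZKind.X else ZKind.Y) m n = dCon A b m n := by
  rw [← Con.conGen_of_con (dCon A b m n), eqvCon]
  congr 1
  ext u v
  have := eqvAux_iff_dEqv (n := n) (b := b) (m := m) (GWord.rep_ofList u.toList)
    (GWord.rep_ofList v.toList)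
  rw [dCon_apply, ← this]
  cases b <;> rfl

instance dCon.finite [Finite A] (b : Bool) (m n : ℕ) : Finite (dCon A b m n).Quotient := by
  obtain ⟨T, _, f, hf⟩ := DEqv.exists_signature (A := A) n b m
  refine Finite.of_injective (β := T) (fun x => Con.liftOn x (fun u => f u.toList)
    fun u v h => (hf _ _).2 h) fun x y => ?_
  induction x using Con.induction_on
  induction y using Con.induction_on
  intro h
  exact (Con.eq _).2 ((hf _ _).1 h)

theorem FreeMonoid.toList_pow_eq_flatten {A : Type*} (w : FreeMonoid A) (k : ℕ) :
    (w ^ k).toList = (List.replicate k w.toList).flatten := by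
  induction k with
  | zero => rfl
  | succ k ih => rw [pow_succ', FreeMonoid.toList_mul, ih, List.replicate_succ, List.flatten_cons]

theorem isJTrivial_dCon [Finite A] (b : Bool) (n : ℕ) :
    IsJTrivial (dCon A b 1 n).Quotient := by
  refine isJTrivial_of_absorb fun a c => ⟨n, fun j hj => ?_⟩
  obtain ⟨a, rfl⟩ := (dCon A b 1 n).mk'_surjective a
  obtain ⟨c, rfl⟩ := (dCon A b 1 n).mk'_surjective c
  have hr : Rich (c * a).toList n ((c * a) ^ j).toList := by
    obtain ⟨h₁, h₂⟩ := rich_flatten_replicate (c * a).toList j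
    rw [← FreeMonoid.toList_pow_eq_flatten] at h₁ h₂
    exact ⟨h₁, fun w hw hl => h₂ w hw (hl.trans hj)⟩
  simp only [← map_mul, ← map_pow]
  refine ⟨(Con.eq _).2 (DEqv.of_rich (hr.append_left ?_) hr),
    (Con.eq _).2 (DEqv.of_rich (hr.append_right ?_) hr)⟩ <;>
  · intro x hx
    simp [hx]

variable {A}

theorem DEqv.absorb_pow [Finite A] {b : Bool} {m n : ℕ} {s u v : FreeMonoid A}
    (h : DEqv (n + 1) (!b) (m + 1) u.toList v.toList) (hu : ∀ a ∈ u.toList, a ∈ s.toList) :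
    DEqv (n + 1) b (m + 2) (dcat b (s ^ (n + 1)).toList u.toList)
      (dcat b (s ^ (n + 1)).toList v.toList) := by
  have := h.absorb hu (fun a ha => hu a ((h.1 a).2 ha)) []
  rw [← FreeMonoid.toList_pow_eq_flatten] at this
  cases b <;> simpa [dcat] using this

theorem dCon_mul_eq_of_rGreen [Finite A] {m n : ℕ} {u v : FreeMonoid A}
    (h : DEqv (n + 1) false (m + 1) u.toList v.toList)
    {e : (dCon A true (m + 2) (n + 1)).Quotient} (he : IsIdempotentElem e)
    (hr : rGreen (e * (dCon A true (m + 2) (n + 1)).mk' u) e) :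
    e * (dCon A true (m + 2) (n + 1)).mk' u = e * (dCon A true (m + 2) (n + 1)).mk' v := by
  obtain ⟨z, hz⟩ := rGreen_mul_iff.1 hr
  obtain ⟨z, rfl⟩ := Con.mk'_surjective z
  obtain ⟨w, rfl⟩ := Con.mk'_surjective e
  rw [← map_mul, ← map_mul] at hz
  have hs := DEqv.absorb_pow (b := true) (s := w * u * z) h fun a ha => by simp [ha]
  have := (Con.eq (dCon A true (m + 2) (n + 1))).2
    (show dCon A true (m + 2) (n + 1) ((w * u * z) ^ (n + 1) * u) ((w * u * z) ^ (n + 1) * v)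
      from hs)
  simp only [← Con.coe_mk', map_mul _ (_ ^ _), map_pow, hz, he.pow_succ_eq] at this
  exact this

theorem dCon_mul_eq_of_lGreen [Finite A] {m n : ℕ} {u v : FreeMonoid A}
    (h : DEqv (n + 1) true (m + 1) u.toList v.toList)
    {e : (dCon A false (m + 2) (n + 1)).Quotient} (he : IsIdempotentElem e)
    (hl : lGreen ((dCon A false (m + 2) (n + 1)).mk' u * e) e) :
    (dCon A false (m + 2) (n + 1)).mk' u * e = (dCon A false (m + 2) (n + 1)).mk' v * e := by
  obtain ⟨z, hz⟩ := lGreen_mul_iff.1 hl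
  obtain ⟨z, rfl⟩ := Con.mk'_surjective z
  obtain ⟨w, rfl⟩ := Con.mk'_surjective e
  rw [← map_mul, ← map_mul] at hz
  have hs := DEqv.absorb_pow (b := false) (s := z * (u * w)) h fun a ha => by simp [ha]
  have := (Con.eq (dCon A false (m + 2) (n + 1))).2
    (show dCon A false (m + 2) (n + 1) (u * (z * (u * w)) ^ (n + 1))
      (v * (z * (u * w)) ^ (n + 1)) from hs)
  simp only [← Con.coe_mk', map_mul _ _ (_ ^ _), map_pow, hz, he.pow_succ_eq] at this
  exact this

theorem simK_mk' [Finite A] {m n : ℕ} {u v : FreeMonoid A}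
    (h : dCon A false (m + 1) (n + 1) u v) :
    simK ((dCon A true (m + 2) (n + 1)).mk' u) ((dCon A true (m + 2) (n + 1)).mk' v) := by
  rintro e he (hr | hr)
  · exact dCon_mul_eq_of_rGreen h he hr
  · exact (dCon_mul_eq_of_rGreen ((dCon A false (m + 1) (n + 1)).symm h) he hr).symm

theorem simD_mk' [Finite A] {m n : ℕ} {u v : FreeMonoid A}
    (h : dCon A true (m + 1) (n + 1) u v) :
    simD ((dCon A false (m + 2) (n + 1)).mk' u) ((dCon A false (m + 2) (n + 1)).mk' v) := by
  rintro e he (hl | hl)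
  · exact dCon_mul_eq_of_lGreen h he hl
  · exact (dCon_mul_eq_of_lGreen ((dCon A true (m + 1) (n + 1)).symm h) he hl).symm

variable (A) in
theorem inRLAux_dCon [Finite A] (m : ℕ) (b : Bool) (n : ℕ) :
    InRLAux m b (dCon A b (m + 1) (n + 1)).Quotient inferInstance := by
  induction m generalizing b with
  | zero => exact isJTrivial_dCon A b (n + 1)
  | succ m ih =>
    cases b
    · obtain ⟨f, hf⟩ := Con.exists_surjective_of_le (c := dCon A true (m + 1) (n + 1))
        (g := (DCon (dCon A false (m + 2) (n + 1)).Quotient).mk'.comp (Con.mk' _))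
        ((Con.mk'_surjective).comp Con.mk'_surjective)
        fun u v h => (Con.eq _).2 (Con.le_conGen _ _ (simD_mk' h))
      exact InRLAux.of_surjective m true hf (ih true)
    · obtain ⟨f, hf⟩ := Con.exists_surjective_of_le (c := dCon A false (m + 1) (n + 1))
        (g := (KCon (dCon A true (m + 2) (n + 1)).Quotient).mk'.comp (Con.mk' _))
        ((Con.mk'_surjective).comp Con.mk'_surjective)
        fun u v h => (Con.eq _).2 (Con.le_conGen _ _ (simK_mk' h))
      exact InRLAux.of_surjective m false hf (ih false)

theorem exists_surjective_dCon_eqvCon_WI [Finite A] (b : Bool) (m n : ℕ) :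
    ∃ f : (dCon A b (m + 1) (2 * n)).Quotient →* (eqvCon A ZKind.WI m n).Quotient,
      Function.Surjective f :=
  Con.exists_surjective_of_le (g := (eqvCon A ZKind.WI m n).mk') Con.mk'_surjective
    fun u v h => (Con.eq _).2 (Con.le_conGen _ _
      (DEqv.eqvAux_WI (GWord.rep_ofList u.toList) (GWord.rep_ofList v.toList) h))

theorem mDivides_prod_dCon [Finite A] (m n : ℕ) :
    MDivides (eqvCon A ZKind.XY m n).Quotient
      ((dCon A true m n).Quotient × (dCon A false m n).Quotient) := by
  let φ := (dCon A true m n).mk'.prod (dCon A false m n).mk'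
  obtain ⟨f, hf⟩ := Con.exists_surjective_of_le (c := Con.ker φ)
    (g := (eqvCon A ZKind.XY m n).mk') Con.mk'_surjective fun u v h => by
      have h' := Prod.mk.inj h
      refine (Con.eq _).2 (Con.le_conGen _ _ ⟨?_, ?_⟩)
      · exact (eqvAux_iff_dEqv (b := true) (GWord.rep_ofList _) (GWord.rep_ofList _)).2
          ((Con.eq (dCon A true m n)).1 h'.1)
      · exact (eqvAux_iff_dEqv (b := false) (GWord.rep_ofList _) (GWord.rep_ofList _)).2
          ((Con.eq (dCon A false m n)).1 h'.2)
  let g := Con.quotientKerEquivRange φ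
  exact ⟨MonoidHom.mrange φ, f.comp g.symm.toMonoidHom, hf.comp g.symm.surjective⟩

end FreeMonoidQuotients

/-- Theorem: the quotients by the relations lie in the respective levels. -/
theorem relations_in_TrotterWeil (A : Type) [Fintype A] (m n : ℕ) (hm : 1 ≤ m) (hn : 1 ≤ n) :
    InRm m (eqvCon A ZKind.X m n).Quotient ∧
    InLm m (eqvCon A ZKind.Y m n).Quotient ∧
    InJoin m (eqvCon A ZKind.XY m n).Quotient ∧
    (InRm (m + 1) (eqvCon A ZKind.WI m n).Quotient ∧
      InLm (m + 1) (eqvCon A ZKind.WI m n).Quotient) := by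
  obtain ⟨m, rfl⟩ := Nat.exists_eq_add_of_le' hm
  obtain ⟨n, rfl⟩ := Nat.exists_eq_add_of_le' hn
  have hX := inRLAux_dCon A m true n
  have hY := inRLAux_dCon A m false n
  refine ⟨?_, ?_, ⟨_, _, inferInstance, inferInstance, dCon.finite A true (m + 1) (n + 1),
    dCon.finite A false (m + 1) (n + 1), hX, hY, mDivides_prod_dCon (m + 1) (n + 1)⟩, ?_, ?_⟩
  · have h := eqvCon_eq_dCon A true (m + 1) (n + 1)
    simp only [cond_true] at h
    rw [h]
    exact hX
  · have h := eqvCon_eq_dCon A false (m + 1) (n + 1)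
    simp only [cond_false] at h
    rw [h]
    exact hY
  · obtain ⟨f, hf⟩ := exists_surjective_dCon_eqvCon_WI (A := A) true (m + 1) (n + 1)
    exact InRLAux.of_surjective (m + 1) true hf (inRLAux_dCon A (m + 1) true (2 * n + 1))
  · obtain ⟨f, hf⟩ := exists_surjective_dCon_eqvCon_WI (A := A) false (m + 1) (n + 1)
    exact InRLAux.of_surjective (m + 1) false hf (inRLAux_dCon A (m + 1) false (2 * n + 1))
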